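/- Let 𝒫 be a graded poset and F : 𝒫 → Ab a functor. Then the inverse limit of F' is isomorphic to the product of all values of F: lim F' ≅ ∏_{p ∈ Ob(𝒫)} F(p). -/

import Mathlib

open Finset

/-- A graded poset (with the standing assumptions of Remark 2.5: the degree function is
order-reversing, adds one along preceding pairs, takes nonnegative values, and every
up-set is finite). -/
structure GradedPoset (P : Type) [PartialOrder P] : Type where
  deg : P → ℤ
  deg_antitone : ∀ ⦃p q : P⦄, p ≤ q → deg q ≤ deg p
  deg_step : ∀ ⦃p q : P⦄, p < q → (∀ r, p ≤ r → r ≤ q → r = p ∨ r = q) → deg p = deg q + 1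
  deg_nonneg : ∀ p, 0 ≤ deg p
  finite_up : ∀ p : P, {q : P | p ≤ q}.Finite

/-- A functor from a poset `P` to the category `Ab` of abelian groups. -/
structure PosetFunctor (P : Type) [PartialOrder P] : Type 1 where
  obj : P → Type
  grp : ∀ p, AddCommGroup (obj p)
  map : ∀ {p q : P}, p ≤ q → obj p →+ obj q
  map_id : ∀ (p : P) (x : obj p), map (le_refl p) x = x
  map_comp : ∀ {p q r : P} (h₁ : p ≤ q) (h₂ : q ≤ r) (x : obj p),
    map h₂ (map h₁ x) = map (h₁.trans h₂) x

attribute [instance] PosetFunctor.grp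

variable {P : Type} [PartialOrder P]

/-- A natural transformation between functors `P → Ab`. -/
structure PosetHom (F G : PosetFunctor P) : Type where
  app : ∀ p : P, F.obj p →+ G.obj p
  naturality : ∀ {p q : P} (h : p ≤ q) (x : F.obj p),
    G.map h (app p x) = app q (F.map h x)

/-- The constant functor with value `ℤ`. -/
def constZ (P : Type) [PartialOrder P] : PosetFunctor P where
  obj _ := ℤ
  grp _ := inferInstance
  map _ := AddMonoidHom.id ℤ
  map_id _ _ := rfl
  map_comp _ _ _ := rfl

namespace PosetFunctor

/-- The inverse limit `lim F` of `F : P → Ab`, realized as the group of compatible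
families (sections). -/
def sections (F : PosetFunctor P) : AddSubgroup (∀ p, F.obj p) where
  carrier := {x | ∀ (p q : P) (h : p ≤ q), F.map h (x p) = x q}
  zero_mem' := by intro p q h; simp
  add_mem' := by intro a b ha hb p q h; simp [map_add, ha p q h, hb p q h]
  neg_mem' := by intro a ha p q h; simp [ha p q h]

/-- The functor `F'` with `F'(p₀) = ∏_{p₀ ≤ p} F(p)`; a morphism `p₁ ≤ p₀` acts by
sending the factor indexed by `p₁ ≤ p` identically to the factor indexed by `p₀ ≤ p`
when `p₀ ≤ p`, and by zero otherwise. -/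
def prime (F : PosetFunctor P) : PosetFunctor P where
  obj p₀ := ∀ q : {q : P // p₀ ≤ q}, F.obj q.1
  grp _ := inferInstance
  map h := AddMonoidHom.mk' (fun x q => x ⟨q.1, h.trans q.2⟩) (fun _ _ => rfl)
  map_id _ _ := rfl
  map_comp _ _ _ := rfl

end PosetFunctor

/-- The subgroup `Ker_F(p₀) = ⋂_{p₀ < q} Ker (F(p₀ → q))`. -/
def kerAt (F : PosetFunctor P) (p₀ : P) : AddSubgroup (F.obj p₀) where
  carrier := {x | ∀ (q : P) (h : p₀ < q), F.map h.le x = 0}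
  zero_mem' := by intro q h; simp
  add_mem' := by intro a b ha hb q h; simp [map_add, ha q h, hb q h]
  neg_mem' := by intro a ha q h; simp [ha q h]

/-- `F` is `n`-condensed: `F(p) = 0` for `deg p < n` and `Ker_F(p) = 0` for `deg p > n`. -/
def IsCondensed (G : GradedPoset P) (F : PosetFunctor P) (n : ℕ) : Prop :=
  (∀ p : P, G.deg p < (n : ℤ) → ∀ x : F.obj p, x = 0) ∧
  (∀ p : P, (n : ℤ) < G.deg p → ∀ x ∈ kerAt F p, x = 0)

/-- The set `(p₀ ↓ P)_n` of objects above `p₀` of degree `n`. -/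
def degSet (G : GradedPoset P) (p₀ : P) (n : ℕ) : Set P :=
  {q : P | p₀ ≤ q ∧ G.deg q = (n : ℤ)}

/-- The functor `Ker'_F` (for an `n`-condensed functor `F`):
`Ker'_F(p₀) = ∏_{p ∈ (p₀↓P)_n} F(p)`. -/
def kerPrime (G : GradedPoset P) (F : PosetFunctor P) (n : ℕ) : PosetFunctor P where
  obj p₀ := ∀ q : degSet G p₀ n, F.obj q.1
  grp _ := inferInstance
  map h := AddMonoidHom.mk' (fun x q => x ⟨q.1, h.trans q.2.1, q.2.2⟩) (fun _ _ => rfl)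
  map_id _ _ := rfl
  map_comp _ _ _ := rfl

/-- The natural transformation `λ : F ⇒ Ker'_F` with components
`λ_{p₀} = ∏_{p ∈ (p₀↓P)_n} F(p₀ → p)`. -/
def lambdaNT (G : GradedPoset P) (F : PosetFunctor P) (n : ℕ) :
    PosetHom F (kerPrime G F n) where
  app p₀ := AddMonoidHom.mk' (fun x q => F.map q.2.1 x)
    (by intro a b; funext q; exact map_add _ a b)
  naturality := by
    intro p q h x
    funext r
    exact (F.map_comp h r.2.1 x).symm

/-! ### The cochain complex computing higher inverse limits -/

/-- Composable chains `p₀ ≤ p₁ ≤ … ≤ pₙ` in `P`. -/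
def ChainP (P : Type) [PartialOrder P] (n : ℕ) : Type :=
  {c : Fin (n + 1) → P // Monotone c}

/-- `n`-cochains of the cobar complex computing the derived functors of `lim` over `P`
with coefficients in `F`. -/
abbrev cochain (F : PosetFunctor P) (n : ℕ) : Type :=
  ∀ c : ChainP P n, F.obj (c.1 (Fin.last n))

/-- The `i`-th face of a chain. -/
def chainFace {n : ℕ} (i : Fin (n + 2)) (c : ChainP P (n + 1)) : ChainP P n :=
  ⟨c.1 ∘ i.succAbove, c.2.comp (Fin.strictMono_succAbove i).monotone⟩

/-- The differential of the cobar complex. -/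
noncomputable def cobarDiff (F : PosetFunctor P) (n : ℕ) : cochain F n →+ cochain F (n + 1) :=
  AddMonoidHom.mk'
    (fun ψ c => ∑ i : Fin (n + 2),
      ((-1 : ℤ) ^ (i : ℕ)) • F.map (c.2 (Fin.le_last (i.succAbove (Fin.last n))))
        (ψ (chainFace i c)))
    (by
      intro a b; funext c
      simp only [Pi.add_apply]
      refine Eq.trans (Finset.sum_congr rfl fun i _ => ?_) Finset.sum_add_distrib
      exact (congrArg (fun y => ((-1 : ℤ) ^ (i : ℕ)) • y)
        (map_add (F.map (c.2 (Fin.le_last (i.succAbove (Fin.last n)))))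
          (a (chainFace i c)) (b (chainFace i c)))).trans (smul_add _ _ _))

/-- Coboundaries of the cobar complex. -/
noncomputable def cobarCoboundaries (F : PosetFunctor P) : ∀ n : ℕ, AddSubgroup (cochain F n)
  | 0 => ⊥
  | n + 1 => (cobarDiff F n).range

/-- `H^n(P; F) = lim^n F`, the cohomology of `P` with coefficients in `F`, computed by
the cobar complex. -/
noncomputable def cohomologyOf (F : PosetFunctor P) (n : ℕ) : Type :=
  (cobarDiff F n).ker ⧸ ((cobarCoboundaries F n).addSubgroupOf (cobarDiff F n).ker)

noncomputable instance (F : PosetFunctor P) (n : ℕ) : AddCommGroup (cohomologyOf F n) :=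
  inferInstanceAs (AddCommGroup (_ ⧸ _))

/-- The `n`-th Betti number of `P` with coefficients in `F`: the rank of `H^n(P;F)`. -/
noncomputable def bettiOf (F : PosetFunctor P) (n : ℕ) : ℕ :=
  Module.finrank ℤ (cohomologyOf F n)

/-! ### Free functors, pure maps, local covering families -/

/-- A functor is free if all its values are finitely generated free abelian groups. -/
def IsFreeFunctor (F : PosetFunctor P) : Prop :=
  ∀ p : P, Module.Free ℤ (F.obj p) ∧ Module.Finite ℤ (F.obj p)

/-- A map of abelian groups is pure if its cokernel is a free abelian group. -/
def IsPureHom {A B : Type} [AddCommGroup A] [AddCommGroup B] (f : A →+ B) : Prop :=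
  Module.Free ℤ (B ⧸ f.range)

/-- Sections of `F` over a subset `S ⊆ P`, i.e. `lim_S F`. -/
def sectionsOnSet (F : PosetFunctor P) (S : Set P) : Set (∀ q : S, F.obj q.1) :=
  {x | ∀ (q r : S) (h : q.1 ≤ r.1), F.map h (x q) = x r}

/-- The restriction map `lim_{(p₀↓P)_*} F → ∏_{q ∈ S} F(q)` (for `S` a set of objects
strictly above `p₀`, realized by intersecting with `{q | p₀ < q}`). -/
def limRestriction (F : PosetFunctor P) (p₀ : P) (S : Set P) :
    ↥(sectionsOnSet F {q : P | p₀ < q}) → ∀ q : ↥(S ∩ {q : P | p₀ < q}), F.obj q.1 :=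
  fun x q => x.1 ⟨q.1, q.2.2⟩

/-- The map `F(p₀) → ∏_{q ∈ S} F(q)` (for `S` a set of objects above `p₀`, realized by
intersecting with `{q | p₀ ≤ q}`). -/
def detMap (F : PosetFunctor P) (p₀ : P) (S : Set P) :
    F.obj p₀ →+ ∀ q : ↥(S ∩ {q : P | p₀ ≤ q}), F.obj q.1 :=
  AddMonoidHom.mk' (fun x q => F.map q.2.2 x) (by intro a b; funext q; exact map_add _ a b)

/-- A local covering family `𝒥 = {J_n^{p₀}}` (Definition 3.4). -/
def IsLCF (G : GradedPoset P) (J : P → ℕ → Set P) : Prop :=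
  (∀ (p : P) (m : ℕ), J p m ⊆ degSet G p m) ∧
  (∀ (p : P) (m : ℕ), (m : ℤ) < G.deg p →
    (⋃ r ∈ J p (m + 1), degSet G r m) = degSet G p m) ∧
  (∀ (p : P) (m : ℕ), ∀ r ∈ J p (m + 1), J r m ⊆ J p m)

/-- `F` (an `n`-condensed free functor) is `𝒥`-determined (Definition 3.5). -/
def IsDetermined (G : GradedPoset P) (J : P → ℕ → Set P) (F : PosetFunctor P) (n : ℕ) :
    Prop :=
  (∀ p₀ : P, (n : ℤ) + 1 < G.deg p₀ →
    Function.Injective (limRestriction F p₀ (J p₀ n)) ∧ IsPureHom (detMap F p₀ (J p₀ n))) ∧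
  (∀ p₀ : P, G.deg p₀ = (n : ℤ) + 1 →
    IsPureHom (detMap F p₀ (J p₀ n)) ∧ Function.Injective (detMap F p₀ (J p₀ n)))

/-- The finite set `(p↓P)_n`. -/
noncomputable def degFinset (G : GradedPoset P) (p : P) (n : ℕ) : Finset P :=
  ((G.finite_up p).subset
    (show degSet G p n ⊆ {q : P | p ≤ q} from fun _ hq => hq.1)).toFinset

/-- The numbers `R_n^{p₀}` (Definition 4.1). -/
noncomputable def Rnum (G : GradedPoset P) : ℕ → P → ℤ
  | 0, _ => 1
  | m + 1, p => (∑ q ∈ degFinset G p m, Rnum G m q) - Rnum G m p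

/-- The finite set `J_n^p` (as a `Finset`, using finiteness of up-sets). -/
noncomputable def JFinset (G : GradedPoset P) (J : P → ℕ → Set P) (p : P) (n : ℕ) :
    Finset P :=
  ((G.finite_up p).inter_of_left (J p n)).toFinset

/-- Connectedness of a subset of a poset, viewed as a full subcategory. -/
def IsConnectedSet (S : Set P) : Prop :=
  S.Nonempty ∧ ∀ a b : S, Relation.ReflTransGen (fun x y : S => x.1 ≤ y.1 ∨ y.1 ≤ x.1) a b

/-- An adequate local covering family (Definition 4.2). -/
def IsAdequate (G : GradedPoset P) (J : P → ℕ → Set P) : Prop :=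
  IsLCF G J ∧
  (∀ p : P, 2 ≤ G.deg p → IsConnectedSet {q : P | p < q}) ∧
  (∀ (m : ℕ) (p : P), (m : ℤ) + 1 ≤ G.deg p →
    Rnum G m p = ∑ q ∈ JFinset G J p m, Rnum G m q)

/-! ### The global complex and global covering families -/

/-- Restriction of a product of abelian groups to a subset of the index set. -/
def restrictTo {ι : Type} {A : ι → Type} [∀ i, AddCommGroup (A i)] (S : Set ι) :
    (∀ i, A i) →+ ∀ i : S, A i.1 :=
  AddMonoidHom.mk' (fun x i => x i.1) (fun _ _ => rfl)

open Classical in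
/-- Extension by zero of a family indexed by a subset of the index set. -/
noncomputable def extendZero {ι : Type} {A : ι → Type} [∀ i, AddCommGroup (A i)]
    (S : Set ι) : (∀ i : S, A i.1) →+ ∀ i, A i :=
  AddMonoidHom.mk' (fun x i => if h : i ∈ S then x ⟨i, h⟩ else 0)
    (by intro a b; funext i; by_cases h : i ∈ S <;> simp [h])

/-- The map on full products induced by a natural transformation
`π : Ker'_F ⇒ F'` (the building block of the differential `d = ι ∘ ω`). -/
noncomputable def dhat (G : GradedPoset P) {F F' : PosetFunctor P} (n : ℕ)
    (π : PosetHom (kerPrime G F n) F') : (∀ p : P, F.obj p) →+ ∀ p : P, F'.obj p :=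
  AddMonoidHom.mk' (fun x p => π.app p (fun q => x q.1))
    (by intro a b; funext p; exact map_add (π.app p) _ _)

/-- The set `Ob_n(P)` of objects of degree `n`. -/
def obSet (G : GradedPoset P) (n : ℕ) : Set P := {p : P | G.deg p = (n : ℤ)}

/-- The differential `d_n = ι_{n+1} ∘ ω_{n+1} : ∏_{Ob_n} F_n(p) → ∏_{Ob_{n+1}} F_{n+1}(p)`. -/
noncomputable def obDiff (G : GradedPoset P) (F : ℕ → PosetFunctor P)
    (π : ∀ n : ℕ, PosetHom (kerPrime G (F n) n) (F (n + 1))) (n : ℕ) :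
    (∀ p : ↥(obSet G n), (F n).obj p.1) →+ ∀ p : ↥(obSet G (n + 1)), (F (n + 1)).obj p.1 :=
  (restrictTo (obSet G (n + 1))).comp ((dhat G n (π n)).comp (extendZero (obSet G n)))

/-- The composite `∏_{p ∈ Ob_n(P)∖K_n} F_n(p) → ∏_{p ∈ K_{n+1}} F_{n+1}(p)`
induced by the differential. -/
noncomputable def wMap (G : GradedPoset P) (F : ℕ → PosetFunctor P)
    (π : ∀ n : ℕ, PosetHom (kerPrime G (F n) n) (F (n + 1))) (K : ℕ → Set P) (n : ℕ) :
    (∀ p : ↥(obSet G n \ K n), (F n).obj p.1) →+ ∀ p : ↥(K (n + 1)), (F (n + 1)).obj p.1 :=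
  (restrictTo (K (n + 1))).comp ((dhat G n (π n)).comp (extendZero (obSet G n \ K n)))

/-- A global covering family (Definition 5.1). -/
def IsGCF (G : GradedPoset P) (F : ℕ → PosetFunctor P)
    (π : ∀ n : ℕ, PosetHom (kerPrime G (F n) n) (F (n + 1))) (K : ℕ → Set P) : Prop :=
  (∀ n : ℕ, K n ⊆ obSet G n) ∧
  (∀ n : ℕ, Function.Injective
    (fun (s : ↥(PosetFunctor.sections (F n))) => (fun p : ↥(K n) => s.1 p.1))) ∧
  (∀ n : ℕ, IsPureHom (wMap G F π K n))

/-- `Ob_n(P)` as a `Finset` (given that each degree level is finite). -/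
noncomputable def obFinset (G : GradedPoset P)
    (hfin : ∀ i : ℤ, {p : P | G.deg p = i}.Finite) (n : ℕ) : Finset P :=
  (hfin (n : ℤ)).toFinset

/-- `K_n` as a `Finset`. -/
noncomputable def KFinset (G : GradedPoset P)
    (hfin : ∀ i : ℤ, {p : P | G.deg p = i}.Finite) (K : ℕ → Set P) (n : ℕ) : Finset P :=
  ((hfin (n : ℤ)).inter_of_left (K n)).toFinset

/-- The Betti numbers `b_n^𝒦` of a global covering family (Definition 5.2). -/
noncomputable def bettiK (G : GradedPoset P)
    (hfin : ∀ i : ℤ, {p : P | G.deg p = i}.Finite) (K : ℕ → Set P) : ℕ → ℤ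
  | 0 => ∑ p ∈ KFinset G hfin K 0, Rnum G 0 p
  | n + 1 =>
      (∑ p ∈ KFinset G hfin K n, Rnum G n p) - (∑ p ∈ obFinset G hfin n, Rnum G n p) +
        ∑ p ∈ KFinset G hfin K (n + 1), Rnum G (n + 1) p

/-- The sequence of functors `F_0 = c_ℤ, F_1, F_2, …` of Proposition 4.3, together with
the connecting short exact sequences `0 → F_{n-1} → Ker'_{F_{n-1}} → F_n → 0` and all
their properties. -/
structure CondensedSequence (G : GradedPoset P) (J : P → ℕ → Set P) : Type 1 where
  F : ℕ → PosetFunctor P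
  pi : ∀ n : ℕ, PosetHom (kerPrime G (F n) n) (F (n + 1))
  F_zero : F 0 = constZ P
  pi_surj : ∀ (n : ℕ) (p : P), Function.Surjective ((pi n).app p)
  pi_ker : ∀ (n : ℕ) (p : P), ((pi n).app p).ker = ((lambdaNT G (F n) n).app p).range
  condensed : ∀ n : ℕ, IsCondensed G (F n) n
  free : ∀ n : ℕ, IsFreeFunctor (F n)
  determined : ∀ n : ℕ, IsDetermined G J (F n) n
  rank_eq : ∀ (n : ℕ) (p : P), (n : ℤ) ≤ G.deg p →
    (Module.finrank ℤ ((F n).obj p) : ℤ) = Rnum G n p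

/-! ### Simplex-like posets -/

/-- The poset `Δ_n` of faces of the standard `n`-dimensional simplex, ordered by
inclusion: faces are the nonempty subsets of the vertex set. -/
def SimplexPoset (n : ℕ) : Type := {s : Finset (Fin (n + 1)) // s.Nonempty}

instance (n : ℕ) : PartialOrder (SimplexPoset n) := Subtype.partialOrder _

/-- A poset `P` is simplex-like (with dimension function `d`) if for every `p` the
category `(P ↓ p)` is isomorphic to `Δ_{d p}`. -/
def SimplexLike (P : Type) [PartialOrder P] (d : P → ℕ) : Prop :=
  ∀ p : P, Nonempty ({q : P // q ≤ p} ≃o SimplexPoset (d p))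

/-- **Theorem 2.7(b).** Let `𝒫` be a graded poset and `F : 𝒫 → Ab` a functor. Then the
inverse limit of `F'` is isomorphic to the product of all the values of `F`:
`lim F' ≅ ∏_{p ∈ Ob 𝒫} F(p)`. -/
theorem theorem_2_7_b {P : Type} [PartialOrder P] (GP : GradedPoset P)
    (F : PosetFunctor P) :
    Nonempty (↥(PosetFunctor.sections F.prime) ≃+ ∀ p : P, F.obj p) := by
  refine ⟨{ toFun := fun s p => s.1 p ⟨p, le_refl p⟩
            invFun := fun x => ⟨fun _ q => x q.1, fun _ _ _ => rfl⟩
            left_inv := ?_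
            right_inv := fun _ => rfl
            map_add' := fun _ _ => rfl }⟩
  intro s
  apply Subtype.ext
  funext p q
  have h := s.2 p q.1 q.2
  exact (congrFun h ⟨q.1, le_refl q.1⟩).symm
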